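/- Let d ≥ 1 and let c_d > 0 be a constant with the following selection property (Pach): for any d+1 disjoint finite sets P_0, …, P_d of points in ℝ^d of equal size, there exist subsets Q_i ⊆ P_i with |Q_i| ≥ c_d·|P_i| and a point x ∈ ℝ^d such that x ∈ conv{q_0, …, q_d} for every choice of q_i ∈ Q_i. Let X be a finite abstract simplicial complex of dimension d on n vertices with a complete skeleton whose number of vertices is divisible by d+1, let k be the average degree of a (d−1)-cell of X, and suppose Spec(Δ+|_{Z_{d-1}}) ⊆ [k − ε, k + ε]. Then overlap(X) ≥ (c_d^d / e^{d+1}) · (c_d − ε(d+1)/k). -/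

import Mathlib

open Finset

/-- A finite abstract simplicial complex on the vertex type `V`: a collection of finite
subsets of `V` (the cells), closed under taking subsets and containing the empty cell. -/
structure SComplex (V : Type) [Fintype V] [DecidableEq V] : Type where
  cells : Finset (Finset V)
  empty_mem : ∅ ∈ cells
  down_closed : ∀ s ∈ cells, ∀ t ⊆ s, t ∈ cells

namespace SComplex

variable {V : Type} [Fintype V] [DecidableEq V]

/-- The cells of `X` with exactly `m` vertices, i.e. the `(m-1)`-dimensional cells `X^{m-1}`. -/
def cellsCard (X : SComplex V) (m : ℕ) : Finset (Finset V) :=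
  X.cells.filter fun s => s.card = m

/-- `X` is `D`-dimensional: every cell has at most `D+1` vertices and some cell has
exactly `D+1` vertices. -/
def Dim (X : SComplex V) (D : ℕ) : Prop :=
  (∀ s ∈ X.cells, s.card ≤ D + 1) ∧ ∃ s ∈ X.cells, s.card = D + 1

/-- `X` (of dimension `D`) has a complete skeleton: every subset of `V` with at most `D`
elements is a cell. -/
def CompleteSkeleton (X : SComplex V) (D : ℕ) : Prop :=
  ∀ s : Finset V, s.card ≤ D → s ∈ X.cells

/-- The set of vertices of an ordered tuple. -/
def tset {m : ℕ} (σ : Fin m → V) : Finset V := Finset.image σ Finset.univ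

/-- An ordered tuple of vertices is an oriented cell when it is injective and its vertex
set is a cell of `X`. -/
def IsCell (X : SComplex V) {m : ℕ} (σ : Fin m → V) : Prop :=
  Function.Injective σ ∧ tset σ ∈ X.cells

instance (X : SComplex V) {m : ℕ} (σ : Fin m → V) : Decidable (X.IsCell σ) := by
  unfold IsCell; infer_instance

/-- `X.nbr v σ` : the vertex `v` does not belong to `σ` and together with `σ` spans a
cell of `X`. -/
def nbr (X : SComplex V) {m : ℕ} (v : V) (σ : Fin m → V) : Prop :=
  v ∉ tset σ ∧ insert v (tset σ) ∈ X.cells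

instance (X : SComplex V) {m : ℕ} (v : V) (σ : Fin m → V) : Decidable (X.nbr v σ) := by
  unfold nbr; infer_instance

/-- `f` is an `(m-1)`-form on `X`: a function on ordered tuples of `m` vertices which is
skew-symmetric with respect to permutations of the tuple, and is supported on the
oriented `(m-1)`-cells of `X`. -/
def IsForm (X : SComplex V) (m : ℕ) (f : (Fin m → V) → ℝ) : Prop :=
  (∀ (σ : Fin m → V) (π : Equiv.Perm (Fin m)),
      f (σ ∘ π) = ((Equiv.Perm.sign π : ℤ) : ℝ) * f σ) ∧
  ∀ σ : Fin m → V, ¬ X.IsCell σ → f σ = 0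

/-- The space `Ω^{m-1}(X)` of `(m-1)`-forms, as a submodule of the functions on tuples. -/
def formSub (X : SComplex V) (m : ℕ) : Submodule ℝ ((Fin m → V) → ℝ) where
  carrier := {f | X.IsForm m f}
  add_mem' := @fun f g hf hg => ⟨fun σ π => by
      simp only [Pi.add_apply, hf.1 σ π, hg.1 σ π]; ring,
    fun σ h => by simp only [Pi.add_apply, hf.2 σ h, hg.2 σ h, add_zero]⟩
  zero_mem' := ⟨fun σ π => by simp, fun σ h => rfl⟩
  smul_mem' := @fun c f hf => ⟨fun σ π => by
      simp only [Pi.smul_apply, smul_eq_mul, hf.1 σ π]; ring,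
    fun σ h => by simp only [Pi.smul_apply, hf.2 σ h, smul_eq_mul, mul_zero]⟩

/-- The inner product `⟨f,g⟩ = ∑_{σ ∈ X^{m-1}} f(σ) g(σ)` on `(m-1)`-forms, computed via
ordered tuples (each cell is counted `m!` times, once for each ordering of its vertices). -/
noncomputable def innerForm (m : ℕ) (f g : (Fin m → V) → ℝ) : ℝ :=
  ((m.factorial : ℝ))⁻¹ * ∑ σ : Fin m → V, f σ * g σ

/-- The boundary operator `∂ : Ω^m → Ω^{m-1}`, `(∂f)(σ) = ∑_{v ∼ σ} f(vσ)`. -/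
def bdry (X : SComplex V) (m : ℕ) (f : (Fin (m+1) → V) → ℝ) : (Fin m → V) → ℝ :=
  fun σ => ∑ v : V, if X.nbr v σ then f (Fin.cons v σ) else 0

/-- The coboundary operator `∂* : Ω^{m-1} → Ω^m`, `(∂*f)(σ) = ∑ i (-1)^i f(σ ∖ σᵢ)`,
supported on the oriented `m`-cells of `X`. -/
def cobdry (X : SComplex V) (m : ℕ) (f : (Fin m → V) → ℝ) : (Fin (m+1) → V) → ℝ :=
  fun σ => if X.IsCell σ then ∑ i : Fin (m+1), (-1 : ℝ) ^ (i : ℕ) * f (σ ∘ i.succAbove) else 0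

/-- The upper Laplacian `Δ⁺ = ∂ ∘ ∂*` on `(m-1)`-forms. -/
def upLap (X : SComplex V) (m : ℕ) (f : (Fin m → V) → ℝ) : (Fin m → V) → ℝ :=
  X.bdry m (X.cobdry m f)

/-- The lower Laplacian `Δ⁻ = ∂* ∘ ∂` on `m`-forms. -/
def lowLap (X : SComplex V) (m : ℕ) (f : (Fin (m+1) → V) → ℝ) : (Fin (m+1) → V) → ℝ :=
  X.cobdry m (X.bdry m f)

/-- The boundary operator as a linear map. -/
def bdryL (X : SComplex V) (m : ℕ) : ((Fin (m+1) → V) → ℝ) →ₗ[ℝ] ((Fin m → V) → ℝ) where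
  toFun := X.bdry m
  map_add' f g := by
    funext σ
    show (∑ v : V, if X.nbr v σ then (f + g) (Fin.cons v σ) else 0) =
      (∑ v : V, if X.nbr v σ then f (Fin.cons v σ) else 0) +
      (∑ v : V, if X.nbr v σ then g (Fin.cons v σ) else 0)
    rw [← Finset.sum_add_distrib]
    exact Finset.sum_congr rfl fun v _ => by by_cases h : X.nbr v σ <;> simp [h]
  map_smul' c f := by
    funext σ
    show (∑ v : V, if X.nbr v σ then (c • f) (Fin.cons v σ) else 0) =
      c * (∑ v : V, if X.nbr v σ then f (Fin.cons v σ) else 0)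
    rw [Finset.mul_sum]
    exact Finset.sum_congr rfl fun v _ => by by_cases h : X.nbr v σ <;> simp [h]

/-- The coboundary operator as a linear map. -/
def cobdryL (X : SComplex V) (m : ℕ) : ((Fin m → V) → ℝ) →ₗ[ℝ] ((Fin (m+1) → V) → ℝ) where
  toFun := X.cobdry m
  map_add' f g := by
    funext σ
    show X.cobdry m (f + g) σ = X.cobdry m f σ + X.cobdry m g σ
    unfold cobdry
    by_cases h : X.IsCell σ
    · simp only [h, if_true, ← Finset.sum_add_distrib]
      exact Finset.sum_congr rfl fun i _ => by simp [Pi.add_apply]; ring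
    · simp [h]
  map_smul' c f := by
    funext σ
    show X.cobdry m (c • f) σ = c * X.cobdry m f σ
    unfold cobdry
    by_cases h : X.IsCell σ
    · simp only [h, if_true, Finset.mul_sum]
      exact Finset.sum_congr rfl fun i _ => by simp [Pi.smul_apply]; ring
    · simp [h]

/-- The degree of a cell `s`: the number of cells with one more vertex containing `s`. -/
def degCell (X : SComplex V) (s : Finset V) : ℕ :=
  (X.cells.filter fun t => s ⊆ t ∧ t.card = s.card + 1).card

/-- The maximal degree of an `(m-1)`-cell of `X`. -/
def maxDeg (X : SComplex V) (m : ℕ) : ℕ :=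
  (X.cellsCard m).sup fun s => X.degCell s

/-- The spectrum of the upper Laplacian of a `(d+1)`-dimensional complex restricted to
the cycle space `Z = ker ∂` inside the space of forms on `d+1` vertices. -/
def specUpLapZ (X : SComplex V) (d : ℕ) : Set ℝ :=
  {μ | ∃ f : (Fin (d+1) → V) → ℝ,
    X.IsForm (d+1) f ∧ X.bdry d f = 0 ∧ f ≠ 0 ∧ X.upLap (d+1) f = μ • f}

/-- The spectral gap `λ(X) = min Spec (Δ⁺|_Z)` of a `(d+1)`-dimensional complex. -/
noncomputable def spectralGap (X : SComplex V) (d : ℕ) : ℝ :=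
  sInf (X.specUpLapZ d)

/-- `F(A 0, …, A (m-1))`: the set of cells with `m` vertices having exactly one vertex
in each `A i`. -/
def Fcells (X : SComplex V) {m : ℕ} (A : Fin m → Finset V) : Finset (Finset V) :=
  X.cells.filter fun s => s.card = m ∧ ∀ i, (s ∩ A i).card = 1

/-- The Cheeger constant of a `(d+1)`-dimensional complex: the minimum over all
partitions of the vertex set into `d+2` nonempty parts of `n·|F(A₀,…)|/∏|Aᵢ|`. -/
noncomputable def cheeger (X : SComplex V) (d : ℕ) : ℝ :=
  sInf { r : ℝ | ∃ A : Fin (d+2) → Finset V,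
    (∀ i, (A i).Nonempty) ∧ (∀ i j, i ≠ j → Disjoint (A i) (A j)) ∧
    Finset.univ.biUnion A = Finset.univ ∧
    r = (Fintype.card V : ℝ) * ((X.Fcells A).card : ℝ) / ∏ i, ((A i).card : ℝ) }

/-- The `m`-th reduced Betti number `β_m = dim H_m` of `X` over `ℝ`:
`dim (Ω^m ∩ ker ∂_m) - dim (∂_{m+1} Ω^{m+1})`. -/
noncomputable def betti (X : SComplex V) (m : ℕ) : ℕ :=
  Module.finrank ℝ ↥(X.formSub (m+1) ⊓ LinearMap.ker (X.bdryL m)) -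
  Module.finrank ℝ ↥(Submodule.map (X.bdryL (m+1)) (X.formSub (m+2)))

/-- The vertices of the link of `τ`. -/
def linkVerts (X : SComplex V) (τ : Finset V) : Finset V :=
  Finset.univ.filter fun v => v ∉ τ ∧ insert v τ ∈ X.cells

/-- The neighbours of `v` in the link graph of `τ`. -/
def linkNbrs (X : SComplex V) (τ : Finset V) (v : V) : Finset V :=
  Finset.univ.filter fun w => w ≠ v ∧ w ∉ τ ∧ v ∉ τ ∧ insert v (insert w τ) ∈ X.cells

/-- The graph Laplacian of the link of `τ`. -/
def linkLap (X : SComplex V) (τ : Finset V) (g : V → ℝ) : V → ℝ :=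
  fun v => ((X.linkNbrs τ v).card : ℝ) * g v - ∑ w ∈ X.linkNbrs τ v, g w

/-- The graph spectral gap of the link of `τ`: the minimal eigenvalue of its graph
Laplacian on functions on its vertices summing to zero. -/
noncomputable def linkGap (X : SComplex V) (τ : Finset V) : ℝ :=
  sInf {μ : ℝ | ∃ g : V → ℝ, (∀ v, v ∉ X.linkVerts τ → g v = 0) ∧
    (∑ v ∈ X.linkVerts τ, g v = 0) ∧ g ≠ 0 ∧
    ∀ v ∈ X.linkVerts τ, X.linkLap τ g v = μ * g v}

/-- The graph Cheeger constant of the link of `τ`: the minimum over partitions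
`B ⊔ C` of its vertex set of `|W|·|E(B,C)|/(|B|·|C|)`. -/
noncomputable def linkCheeger (X : SComplex V) (τ : Finset V) : ℝ :=
  sInf { r : ℝ | ∃ B C : Finset V, B.Nonempty ∧ C.Nonempty ∧ Disjoint B C ∧
    B ∪ C = X.linkVerts τ ∧
    r = ((X.linkVerts τ).card : ℝ) *
        (((B ×ˢ C).filter fun p => insert p.1 (insert p.2 τ) ∈ X.cells).card : ℝ) /
        ((B.card : ℝ) * (C.card : ℝ)) }

/-- `deg_τ(s)`: the number of neighbours `s'` of the cell `s` which contain `τ` (two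
distinct cells with the same number of vertices are neighbours when their union is a
cell of `X` with one more vertex). -/
def degTau (X : SComplex V) (τ s : Finset V) : ℕ :=
  (X.cells.filter fun s' => s'.card = s.card ∧ s' ≠ s ∧ τ ⊆ s' ∧
    (s ∪ s').card = s.card + 1 ∧ s ∪ s' ∈ X.cells).card

/-- The local upper Laplacian `Δ⁺_τ` associated to a cell `τ` with `d` vertices of a
`(d+1)`-dimensional complex, acting on forms on `d+1` vertices:
`(Δ⁺_τ f)(σ) = deg_τ(σ) f(σ) - ∑_{σ' ∼ σ, τ ⊆ σ'} f(σ')` when `τ ⊆ σ`, and `0` else. -/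
def localUpLap (X : SComplex V) (d : ℕ) (τ : Finset V) (f : (Fin (d+1) → V) → ℝ) :
    (Fin (d+1) → V) → ℝ :=
  fun σ => if τ ⊆ tset σ then
      (X.degTau τ (tset σ) : ℝ) * f σ -
        ∑ v : V, if X.nbr v σ then
          ∑ i : Fin (d+1), if σ i ∉ τ then
            (-1 : ℝ) ^ (i : ℕ) * f (Fin.cons v σ ∘ Fin.succAbove i.succ) else 0
        else 0
    else 0

/-- The complement complex `X̄` of a `D`-dimensional complex `X` with complete skeleton:
it has the same cells of dimension `< D`, and its `D`-dimensional cells are exactly the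
vertex sets of size `D+1` which are not cells of `X`. -/
def complComplex (X : SComplex V) (D : ℕ) (hX : X.CompleteSkeleton D) : SComplex V where
  cells := (X.cells.filter fun s => s.card ≤ D) ∪
    ((Finset.univ : Finset V).powersetCard (D+1)).filter fun s => s ∉ X.cells
  empty_mem := Finset.mem_union_left _ (Finset.mem_filter.mpr ⟨X.empty_mem, by simp⟩)
  down_closed := by
    intro s hs t ht
    rcases Finset.mem_union.mp hs with h | h
    · rw [Finset.mem_filter] at h
      exact Finset.mem_union_left _ (Finset.mem_filter.mpr
        ⟨X.down_closed s h.1 t ht, le_trans (Finset.card_le_card ht) h.2⟩)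
    · rw [Finset.mem_filter, Finset.mem_powersetCard] at h
      by_cases hts : t = s
      · subst hts
        exact Finset.mem_union_right _ (Finset.mem_filter.mpr
          ⟨Finset.mem_powersetCard.mpr h.1, h.2⟩)
      · have hlt : t.card < s.card := Finset.card_lt_card (ht.ssubset_of_ne hts)
        have hsD : s.card = D + 1 := h.1.2
        have htD : t.card ≤ D := by omega
        exact Finset.mem_union_left _ (Finset.mem_filter.mpr ⟨hX t htD, htD⟩)

/-- The simplicial complex on `V` with complete `(d+1)`-dimensional skeleton whose
top-dimensional cells (with `d+2` vertices) are the members of `T`: the Linial–Meshulam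
complex determined by the sample `T`. -/
def lmComplex (V : Type) [Fintype V] [DecidableEq V] (d : ℕ) (T : Finset (Finset V)) :
    SComplex V where
  cells := (Finset.univ.powerset.filter fun s : Finset V => s.card ≤ d + 1) ∪
    T.filter fun s => s.card = d + 2
  empty_mem := Finset.mem_union_left _ (by simp)
  down_closed := by
    intro s hs t ht
    rcases Finset.mem_union.mp hs with h | h
    · rw [Finset.mem_filter] at h
      exact Finset.mem_union_left _ (Finset.mem_filter.mpr
        ⟨Finset.mem_powerset.mpr (Finset.subset_univ t), le_trans (Finset.card_le_card ht) h.2⟩)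
    · rw [Finset.mem_filter] at h
      by_cases hts : t = s
      · subst hts; exact Finset.mem_union_right _ (Finset.mem_filter.mpr h)
      · have hlt : t.card < s.card := Finset.card_lt_card (ht.ssubset_of_ne hts)
        have hsd : s.card = d + 2 := h.2
        have htd : t.card ≤ d + 1 := by omega
        exact Finset.mem_union_left _ (Finset.mem_filter.mpr
          ⟨Finset.mem_powerset.mpr (Finset.subset_univ t), htd⟩)

open Classical in
/-- The probability, under the Linial–Meshulam measure `X(d+1, n, p)` (each possible
top-dimensional cell on `d+2` vertices is included independently with probability `p`),
of an event `E` depending on the set of top-dimensional cells. -/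
noncomputable def lmProb (V : Type) [Fintype V] [DecidableEq V] (d : ℕ) (p : ℝ)
    (E : Finset (Finset V) → Prop) : ℝ :=
  ∑ T ∈ ((Finset.univ : Finset V).powersetCard (d+2)).powerset,
    if E T then
      p ^ T.card * (1 - p) ^ (((Finset.univ : Finset V).powersetCard (d+2)).card - T.card)
    else 0

end SComplex

namespace SComplex

section Alternating

variable {V : Type} {m : ℕ}

/-- A function on ordered tuples is skew when permuting the entries multiplies it by the sign. -/
def Skew (f : (Fin m → V) → ℝ) : Prop :=
  ∀ (σ : Fin m → V) (π : Equiv.Perm (Fin m)),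
    f (σ ∘ π) = ((Equiv.Perm.sign π : ℤ) : ℝ) * f σ

/-- The alternating sum of `f` over the faces of a tuple: the coboundary of `f` in the complete
complex. -/
def altFaces (f : (Fin m → V) → ℝ) : (Fin (m + 1) → V) → ℝ :=
  fun σ => ∑ i : Fin (m + 1), (-1 : ℝ) ^ (i : ℕ) * f (σ ∘ i.succAbove)

/-- The sum of `f` over the first entry: the boundary of `f` in the complete complex. -/
def sumCons [Fintype V] (f : (Fin (m + 1) → V) → ℝ) : (Fin m → V) → ℝ :=
  fun σ => ∑ v : V, f (Fin.cons v σ)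

lemma sign_mul_self (π : Equiv.Perm (Fin m)) :
    ((Equiv.Perm.sign π : ℤ) : ℝ) * ((Equiv.Perm.sign π : ℤ) : ℝ) = 1 := by
  rcases Int.units_eq_one_or (Equiv.Perm.sign π) with h | h <;> simp [h]

lemma Skew.eq_zero_of_not_injective {f : (Fin m → V) → ℝ} (hf : Skew f) {σ : Fin m → V}
    (hσ : ¬ Function.Injective σ) : f σ = 0 := by
  simp only [Function.Injective, not_forall] at hσ
  obtain ⟨i, j, hij, hne⟩ := hσ
  have h := hf σ (Equiv.swap i j)
  have h2 : σ ∘ Equiv.swap i j = σ := by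
    funext l
    simp only [Function.comp_apply, Equiv.swap_apply_def]
    split_ifs with h1 h2 <;> simp_all
  rw [h2, Equiv.Perm.sign_swap hne] at h
  push_cast at h
  linarith

lemma exists_decomposeFin_of_apply_zero {π : Equiv.Perm (Fin (m + 1))} (h : π 0 = 0) :
    ∃ e : Equiv.Perm (Fin m), (π : Fin (m + 1) → Fin (m + 1)) ∘ Fin.succ = Fin.succ ∘ e ∧
      Equiv.Perm.sign π = Equiv.Perm.sign e := by
  obtain ⟨⟨p, e⟩, rfl⟩ := Equiv.Perm.decomposeFin.symm.surjective π
  rw [Equiv.Perm.decomposeFin_symm_apply_zero] at h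
  subst h
  refine ⟨e, ?_, ?_⟩
  · funext x
    simp
  · simp

lemma Skew.tail_eq {f : (Fin m → V) → ℝ} (hf : Skew f) (σ : Fin (m + 1) → V)
    {ρ ρ' : Equiv.Perm (Fin (m + 1))} (h : ρ 0 = ρ' 0) :
    ((Equiv.Perm.sign ρ : ℤ) : ℝ) * f (σ ∘ ρ ∘ Fin.succ) =
      ((Equiv.Perm.sign ρ' : ℤ) : ℝ) * f (σ ∘ ρ' ∘ Fin.succ) := by
  obtain ⟨e, he, hs⟩ := exists_decomposeFin_of_apply_zero (π := ρ⁻¹ * ρ') (by simp [← h])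
  have h1 : σ ∘ ρ' ∘ Fin.succ = (σ ∘ ρ ∘ Fin.succ) ∘ e := by
    rw [Function.comp_assoc, Function.comp_assoc, ← he]
    funext x
    simp
  have h2 : Equiv.Perm.sign ρ' = Equiv.Perm.sign ρ * Equiv.Perm.sign e := by
    rw [← hs, ← map_mul]
    simp
  rw [h1, hf, h2]
  push_cast
  have := sign_mul_self e
  linear_combination (-((Equiv.Perm.sign ρ : ℤ) : ℝ) * f (σ ∘ ρ ∘ Fin.succ)) * this

lemma comp_succAbove_eq (σ : Fin (m + 1) → V) (i : Fin (m + 1)) :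
    σ ∘ i.succAbove = σ ∘ (i.cycleRange.symm) ∘ Fin.succ := by
  funext j
  simp

lemma sign_cycleRange_symm (i : Fin (m + 1)) :
    ((Equiv.Perm.sign i.cycleRange.symm : ℤ) : ℝ) = (-1) ^ (i : ℕ) := by
  rw [Equiv.Perm.sign_symm, Fin.sign_cycleRange]
  push_cast
  rfl

lemma altFaces_eq (f : (Fin m → V) → ℝ) (σ : Fin (m + 1) → V) :
    altFaces f σ = ∑ i : Fin (m + 1),
      ((Equiv.Perm.sign i.cycleRange.symm : ℤ) : ℝ) * f (σ ∘ i.cycleRange.symm ∘ Fin.succ) := by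
  simp only [altFaces, comp_succAbove_eq, sign_cycleRange_symm]

lemma Skew.altFaces {f : (Fin m → V) → ℝ} (hf : Skew f) : Skew (altFaces f) := by
  intro σ π
  rw [altFaces_eq, altFaces_eq f σ, Finset.mul_sum, ← Equiv.sum_comp π (fun i => _ * (_ * _))]
  refine Finset.sum_congr rfl fun i _ => ?_
  have h := hf.tail_eq σ (ρ := π * i.cycleRange.symm) (ρ' := (π i).cycleRange.symm) (by simp)
  have h4 : ((Equiv.Perm.sign (π * i.cycleRange.symm) : ℤ) : ℝ) = ((Equiv.Perm.sign π : ℤ) : ℝ) *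
      ((Equiv.Perm.sign i.cycleRange.symm : ℤ) : ℝ) := by
    rw [map_mul, Units.val_mul, Int.cast_mul]
  have h2 := sign_mul_self π
  have h3 : (σ ∘ π) ∘ i.cycleRange.symm ∘ Fin.succ = σ ∘ (π * i.cycleRange.symm) ∘ Fin.succ := rfl
  rw [← h, h4, h3]
  linear_combination (-((Equiv.Perm.sign i.cycleRange.symm : ℤ) : ℝ) *
    f (σ ∘ (π * i.cycleRange.symm) ∘ Fin.succ)) * h2

lemma altFaces_cons (f : (Fin (m + 1) → V) → ℝ) (v : V) (σ : Fin (m + 1) → V) :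
    altFaces f (Fin.cons v σ) = f σ -
      ∑ i : Fin (m + 1), (-1 : ℝ) ^ (i : ℕ) * f (Fin.cons v (σ ∘ i.succAbove)) := by
  have h0 : (Fin.cons v σ : Fin (m + 2) → V) ∘ (0 : Fin (m + 2)).succAbove = σ := by
    funext j; simp
  have hs : ∀ i : Fin (m + 1), (Fin.cons v σ : Fin (m + 2) → V) ∘ i.succ.succAbove =
      Fin.cons v (σ ∘ i.succAbove) := by
    intro i
    funext j
    refine Fin.cases ?_ (fun j => ?_) j <;> simp
  rw [altFaces, Fin.sum_univ_succ, h0, sub_eq_add_neg, ← Finset.sum_neg_distrib]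
  simp only [hs, Fin.val_zero, pow_zero, one_mul, Fin.val_succ, pow_succ]
  simp

variable [Fintype V]

lemma sum_tuple_succ (F : (Fin (m + 1) → V) → ℝ) :
    ∑ σ, F σ = ∑ τ : Fin m → V, ∑ v : V, F (Fin.cons v τ) := by
  rw [← Equiv.sum_comp (Fin.consEquiv (fun _ : Fin (m + 1) => V)), Fintype.sum_prod_type_right]
  rfl

lemma sum_comp_perm (F : (Fin m → V) → ℝ) (π : Equiv.Perm (Fin m)) :
    ∑ σ : Fin m → V, F (σ ∘ π) = ∑ σ, F σ :=
  Equiv.sum_comp (Equiv.arrowCongr π.symm (Equiv.refl V)) F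

lemma Skew.sumCons {f : (Fin (m + 1) → V) → ℝ} (hf : Skew f) : Skew (sumCons f) := by
  intro σ π
  simp only [SComplex.sumCons, Finset.mul_sum]
  refine Finset.sum_congr rfl fun v _ => ?_
  rw [show ((Equiv.Perm.sign π : ℤ) : ℝ) =
    ((Equiv.Perm.sign (Equiv.Perm.decomposeFin.symm (0, π)) : ℤ) : ℝ) by simp, ← hf]
  congr 1
  funext j
  refine Fin.cases ?_ (fun j => ?_) j <;> simp

/-- The boundary and the coboundary of the complete complex are adjoint on skew functions. -/
lemma sum_altFaces_mul {f : (Fin m → V) → ℝ} {h : (Fin (m + 1) → V) → ℝ} (hh : Skew h) :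
    ∑ σ, altFaces f σ * h σ = (m + 1) * ∑ τ, f τ * sumCons h τ := by
  have key : ∀ i : Fin (m + 1), ∑ σ : Fin (m + 1) → V,
      ((-1 : ℝ) ^ (i : ℕ) * f (σ ∘ i.succAbove)) * h σ = ∑ τ, f τ * sumCons h τ := by
    intro i
    rw [← sum_comp_perm _ i.cycleRange, sum_tuple_succ]
    refine Finset.sum_congr rfl fun τ _ => ?_
    rw [sumCons, Finset.mul_sum]
    refine Finset.sum_congr rfl fun v _ => ?_
    rw [hh, Fin.sign_cycleRange, comp_succAbove_eq]
    have : ((Fin.cons v τ : Fin (m + 1) → V) ∘ i.cycleRange) ∘ i.cycleRange.symm ∘ Fin.succ = τ := by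
      funext j
      simp
    rw [this]
    push_cast
    have : ((-1 : ℝ) ^ (i : ℕ)) * (-1) ^ (i : ℕ) = 1 := by
      rw [← mul_pow]; simp
    linear_combination (f τ * h (Fin.cons v τ)) * this
  simp only [altFaces, Finset.sum_mul]
  rw [Finset.sum_comm]
  simp [key]

lemma Skew.sumCons_sumCons {f : (Fin (m + 2) → V) → ℝ} (hf : Skew f) :
    SComplex.sumCons (SComplex.sumCons f) = 0 := by
  funext σ
  have h : ∀ v w : V, f (Fin.cons v (Fin.cons w σ)) = - f (Fin.cons w (Fin.cons v σ)) := by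
    intro v w
    have := hf (Fin.cons w (Fin.cons v σ)) (Equiv.swap 0 1)
    rw [Equiv.Perm.sign_swap (by simp)] at this
    push_cast at this
    rw [← neg_one_mul, ← this]
    congr 1
    funext j
    refine Fin.cases ?_ (fun j => Fin.cases ?_ (fun j => ?_) j) j
    · simp only [Function.comp_apply, Equiv.swap_apply_left, Fin.cons_zero]
      rfl
    · simp only [Function.comp_apply, Fin.succ_zero_eq_one, Equiv.swap_apply_right]
      rfl
    · rw [Function.comp_apply, Equiv.swap_apply_of_ne_of_ne (Fin.succ_ne_zero _)
        (Fin.ne_of_val_ne (by simp))]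
      simp
  have h2 : SComplex.sumCons (SComplex.sumCons f) σ = - SComplex.sumCons (SComplex.sumCons f) σ := by
    conv_lhs => rw [SComplex.sumCons]
    simp only [SComplex.sumCons]
    conv_lhs => rw [Finset.sum_comm]
    rw [← Finset.sum_neg_distrib]
    refine Finset.sum_congr rfl fun v _ => ?_
    rw [← Finset.sum_neg_distrib]
    exact Finset.sum_congr rfl fun w _ => h _ _
  simp only [Pi.zero_apply]
  linarith

lemma Skew.altFaces_altFaces {f : (Fin m → V) → ℝ} (hf : Skew f) :
    SComplex.altFaces (SComplex.altFaces f) = 0 := by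
  have h : ∑ σ, SComplex.altFaces (SComplex.altFaces f) σ *
      SComplex.altFaces (SComplex.altFaces f) σ = 0 := by
    rw [sum_altFaces_mul hf.altFaces.altFaces, sum_altFaces_mul hf.altFaces.altFaces.sumCons,
      hf.altFaces.altFaces.sumCons_sumCons]
    simp
  rw [Finset.sum_eq_zero_iff_of_nonneg fun σ _ => mul_self_nonneg _] at h
  funext σ
  exact mul_self_eq_zero.mp (h σ (Finset.mem_univ σ))

/-- The Laplacians of the complete complex add up to the number of vertices. -/
lemma sumCons_altFaces (f : (Fin (m + 1) → V) → ℝ) (σ : Fin (m + 1) → V) :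
    sumCons (altFaces f) σ = Fintype.card V * f σ - altFaces (sumCons f) σ := by
  simp only [sumCons, altFaces_cons, Finset.sum_sub_distrib]
  rw [Finset.sum_comm]
  simp [altFaces, sumCons, Finset.mul_sum]

end Alternating

end SComplex

namespace SComplex

section Forms

variable {V : Type} [DecidableEq V] {m : ℕ}

lemma tset_comp_perm (σ : Fin m → V) (π : Equiv.Perm (Fin m)) : tset (σ ∘ π) = tset σ := by
  ext v
  simp only [tset, Finset.mem_image, Finset.mem_univ, true_and, Function.comp_apply]
  exact π.surjective.exists (p := fun i => σ i = v) |>.symm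

lemma tset_cons (v : V) (σ : Fin m → V) :
    tset (Fin.cons v σ : Fin (m + 1) → V) = insert v (tset σ) := by
  ext w
  simp [tset, Fin.exists_fin_succ, eq_comm]

variable [Fintype V] {X : SComplex V}

lemma isCell_comp_perm (σ : Fin m → V) (π : Equiv.Perm (Fin m)) :
    X.IsCell (σ ∘ π) ↔ X.IsCell σ := by
  rw [IsCell, IsCell, tset_comp_perm]
  exact and_congr_left' (EquivLike.injective_comp π σ)

lemma isCell_cons (v : V) (σ : Fin m → V) :
    X.IsCell (Fin.cons v σ : Fin (m + 1) → V) ↔ Function.Injective σ ∧ X.nbr v σ := by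
  rw [IsCell, tset_cons, Fin.cons_injective_iff, nbr]
  simp only [tset, Finset.mem_image, Finset.mem_univ, true_and, Set.mem_range]
  tauto

lemma IsForm.skew {f : (Fin m → V) → ℝ} (hf : X.IsForm m f) : Skew f := hf.1

lemma IsForm.bdry_eq {f : (Fin (m + 1) → V) → ℝ} (hf : X.IsForm (m + 1) f) :
    X.bdry m f = sumCons f := by
  funext σ
  refine Finset.sum_congr rfl fun v _ => ?_
  split_ifs with h
  · rfl
  · rw [hf.2 _ fun hc => h ((isCell_cons v σ).mp hc).2]

lemma IsForm.bdry {f : (Fin (m + 1) → V) → ℝ} (hf : X.IsForm (m + 1) f) :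
    X.IsForm m (X.bdry m f) := by
  rw [hf.bdry_eq]
  refine ⟨hf.skew.sumCons, fun σ hσ => Finset.sum_eq_zero fun v _ => hf.2 _ fun hc => hσ ?_⟩
  rw [isCell_cons] at hc
  exact ⟨hc.1, X.down_closed _ hc.2.2 _ (Finset.subset_insert _ _)⟩

lemma cobdry_apply (f : (Fin m → V) → ℝ) (σ : Fin (m + 1) → V) :
    X.cobdry m f σ = if X.IsCell σ then altFaces f σ else 0 := rfl

lemma isForm_cobdry {f : (Fin m → V) → ℝ} (hf : Skew f) : X.IsForm (m + 1) (X.cobdry m f) := by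
  refine ⟨fun σ π => ?_, fun σ hσ => if_neg hσ⟩
  simp only [cobdry_apply, isCell_comp_perm, hf.altFaces σ π]
  split_ifs <;> simp

lemma isForm_upLap {f : (Fin m → V) → ℝ} (hf : Skew f) : X.IsForm m (X.upLap m f) :=
  (isForm_cobdry hf).bdry

lemma bdry_upLap {f : (Fin (m + 1) → V) → ℝ} (hf : Skew f) :
    X.bdry m (X.upLap (m + 1) f) = 0 := by
  rw [(isForm_upLap hf).bdry_eq, upLap, (isForm_cobdry hf).bdry_eq,
    (isForm_cobdry hf).skew.sumCons_sumCons]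

/-- The upper Laplacian is the form `⟨∂* f, ∂* g⟩`, up to the number of orderings. -/
lemma sum_mul_upLap (f : (Fin m → V) → ℝ) {g : (Fin m → V) → ℝ} (hg : Skew g) :
    (m + 1) * ∑ σ, f σ * X.upLap m g σ = ∑ σ, X.cobdry m f σ * X.cobdry m g σ := by
  rw [upLap, (isForm_cobdry hg).bdry_eq, ← sum_altFaces_mul (isForm_cobdry hg).skew]
  refine Finset.sum_congr rfl fun σ _ => ?_
  simp only [cobdry_apply]
  split_ifs <;> simp

lemma sum_mul_upLap_comm {f g : (Fin m → V) → ℝ} (hf : Skew f) (hg : Skew g) :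
    ∑ σ, f σ * X.upLap m g σ = ∑ σ, X.upLap m f σ * g σ := by
  have h1 := sum_mul_upLap (X := X) f hg
  have h2 := sum_mul_upLap (X := X) g hf
  have h3 : ∑ σ, X.cobdry m f σ * X.cobdry m g σ = ∑ σ, X.cobdry m g σ * X.cobdry m f σ :=
    Finset.sum_congr rfl fun σ _ => mul_comm _ _
  have h4 : ∑ σ, X.upLap m f σ * g σ = ∑ σ, g σ * X.upLap m f σ :=
    Finset.sum_congr rfl fun σ _ => mul_comm _ _
  have h5 : (0 : ℝ) < m + 1 := by positivity
  rw [h4]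
  exact mul_left_cancel₀ h5.ne' (by rw [h1, h2, h3])

lemma upLap_altFaces {f : (Fin m → V) → ℝ} (hf : Skew f) :
    X.upLap (m + 1) (altFaces f) = 0 := by
  have h : X.cobdry (m + 1) (altFaces f) = 0 := by
    funext σ
    rw [cobdry_apply, hf.altFaces_altFaces]
    simp
  funext σ
  rw [upLap, h]
  simp [bdry]

lemma CompleteSkeleton.isForm {D : ℕ} (hX : X.CompleteSkeleton D) (hm : m ≤ D)
    {f : (Fin m → V) → ℝ} (hf : Skew f) : X.IsForm m f := by
  refine ⟨hf, fun σ hσ => hf.eq_zero_of_not_injective fun hi => hσ ⟨hi, hX _ ?_⟩⟩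
  exact (Finset.card_image_le.trans (by simp)).trans hm

end Forms

section MinorForm

variable {V : Type} [DecidableEq V] {m : ℕ}

/-- The signed indicator of the tuples meeting each of the sets `A i` once. -/
def minorForm (A : Fin m → Finset V) : (Fin m → V) → ℝ :=
  fun σ => Matrix.det (Matrix.of fun i j => if σ j ∈ A i then (1 : ℝ) else 0)

lemma skew_minorForm (A : Fin m → Finset V) : Skew (minorForm A) := by
  intro σ π
  exact Matrix.det_permute' π (Matrix.of fun i j => if σ j ∈ A i then (1 : ℝ) else 0)

lemma minorForm_eq_zero_of_col {A : Fin m → Finset V} {σ : Fin m → V} (j : Fin m)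
    (h : ∀ i, σ j ∉ A i) : minorForm A σ = 0 :=
  Matrix.det_eq_zero_of_column_eq_zero j fun i => if_neg (h i)

lemma minorForm_eq_zero_of_row {A : Fin m → Finset V} {σ : Fin m → V} (i : Fin m)
    (h : ∀ j, σ j ∉ A i) : minorForm A σ = 0 :=
  Matrix.det_eq_zero_of_row_eq_zero i fun j => if_neg (h j)

lemma minorForm_eq_one {A : Fin m → Finset V} (hA : Pairwise fun i j => Disjoint (A i) (A j))
    {σ : Fin m → V} (h : ∀ i, σ i ∈ A i) : minorForm A σ = 1 := by
  have : (Matrix.of fun i j => if σ j ∈ A i then (1 : ℝ) else 0) = 1 := by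
    ext i j
    rw [Matrix.of_apply, Matrix.one_apply]
    by_cases hij : i = j
    · subst hij
      simp [h]
    · rw [if_neg hij, if_neg]
      exact fun hi => Finset.disjoint_left.mp (hA hij) hi (h j)
  rw [minorForm, this, Matrix.det_one]

/-- Pairing with `minorForm A` sums over the tuples in `∏ A i`. -/
lemma sum_minorForm_mul [Fintype V] (A : Fin m → Finset V) {h : (Fin m → V) → ℝ} (hh : Skew h) :
    ∑ σ, minorForm A σ * h σ = m.factorial * ∑ σ ∈ Fintype.piFinset A, h σ := by
  have key : ∀ π : Equiv.Perm (Fin m), ∑ σ : Fin m → V, (((Equiv.Perm.sign π : ℤ) : ℝ) *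
      ∏ i, (if σ i ∈ A (π i) then (1 : ℝ) else 0)) * h σ = ∑ σ ∈ Fintype.piFinset A, h σ := by
    intro π
    rw [← sum_comp_perm _ π, ← Finset.sum_filter_add_sum_filter_not _ (· ∈ Fintype.piFinset A)]
    rw [Finset.filter_mem_eq_inter, Finset.univ_inter]
    refine (congrArg₂ (· + ·) ?_ ?_).trans (add_zero (∑ σ ∈ Fintype.piFinset A, h σ))
    · refine Finset.sum_congr rfl fun σ hσ => ?_
      rw [Fintype.mem_piFinset] at hσ
      rw [hh, Finset.prod_eq_one]
      · linear_combination (h σ) * sign_mul_self π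
      · intro i _
        simp [hσ]
    · refine Finset.sum_eq_zero fun σ hσ => ?_
      simp only [Finset.mem_filter, Finset.mem_univ, true_and, Fintype.mem_piFinset,
        not_forall] at hσ
      obtain ⟨i, hi⟩ := hσ
      rw [Finset.prod_eq_zero (Finset.mem_univ (π.symm i))]
      · simp
      · simp [hi]
  simp only [minorForm, Matrix.det_apply', Matrix.of_apply, Finset.sum_mul]
  rw [Finset.sum_comm]
  simp only [key]
  simp [Fintype.card_perm]

end MinorForm

end SComplex

/-- A symmetric operator with all eigenvalues in `[k - ε, k + ε]` differs from `k` by at most `ε`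
in operator norm. -/
lemma LinearMap.IsSymmetric.norm_smul_sub_le {E : Type*} [NormedAddCommGroup E]
    [InnerProductSpace ℝ E] [FiniteDimensional ℝ E] {T : E →ₗ[ℝ] E} (hT : T.IsSymmetric)
    {k ε : ℝ} (h : ∀ μ, Module.End.HasEigenvalue T μ → |k - μ| ≤ ε) (x : E) :
    ‖k • x - T x‖ ≤ ε * ‖x‖ := by
  rcases eq_or_ne x 0 with rfl | hx
  · simp
  have : Nontrivial E := ⟨x, 0, hx⟩
  let b := hT.eigenvectorBasis (rfl : Module.finrank ℝ E = Module.finrank ℝ E)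
  let l := hT.eigenvalues (rfl : Module.finrank ℝ E = Module.finrank ℝ E)
  have hl : ∀ i, |k - l i| ≤ ε := fun i => h _ (hT.hasEigenvalue_eigenvalues rfl i)
  have hε : 0 ≤ ε := (abs_nonneg _).trans (hl ⟨0, Module.finrank_pos⟩)
  refine le_of_sq_le_sq ?_ (by positivity)
  rw [mul_pow, ← b.sum_sq_norm_inner_right, ← b.sum_sq_norm_inner_right x, Finset.mul_sum]
  refine Finset.sum_le_sum fun i _ => ?_
  have h1 : inner ℝ (b i) (k • x - T x) = (k - l i) * inner ℝ (b i) x := by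
    have h2 : T (b i) = l i • b i := hT.apply_eigenvectorBasis rfl i
    rw [inner_sub_right, inner_smul_right, ← hT, h2, real_inner_smul_left]
    ring
  rw [h1, norm_mul, mul_pow, Real.norm_eq_abs]
  gcongr
  exact hl i

namespace SComplex

section Spectrum

variable {V : Type} [Fintype V] [DecidableEq V] (X : SComplex V) (d : ℕ)

/-- The cycle space `Z = ker ∂` with the Euclidean inner product. -/
def cycleSub : Submodule ℝ (EuclideanSpace ℝ (Fin (d + 1) → V)) :=
  (X.formSub (d + 1) ⊓ LinearMap.ker (X.bdryL d)).comap
    (WithLp.linearEquiv 2 ℝ ((Fin (d + 1) → V) → ℝ)).toLinearMap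

variable {X d}

lemma mem_cycleSub {f : EuclideanSpace ℝ (Fin (d + 1) → V)} :
    f ∈ X.cycleSub d ↔ X.IsForm (d + 1) f.ofLp ∧ X.bdry d f.ofLp = 0 := Iff.rfl

variable (X d)

/-- The upper Laplacian on the cycle space. -/
def cycleLap : X.cycleSub d →ₗ[ℝ] X.cycleSub d :=
  LinearMap.restrict ((WithLp.linearEquiv 2 ℝ ((Fin (d + 1) → V) → ℝ)).symm.toLinearMap ∘ₗ
      (X.bdryL (d + 1) ∘ₗ X.cobdryL (d + 1)) ∘ₗ
      (WithLp.linearEquiv 2 ℝ ((Fin (d + 1) → V) → ℝ)).toLinearMap)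
    fun _ hf => mem_cycleSub.mpr ⟨isForm_upLap (mem_cycleSub.mp hf).1.skew,
      bdry_upLap (mem_cycleSub.mp hf).1.skew⟩

variable {X d}

lemma cycleLap_apply (f : X.cycleSub d) :
    (X.cycleLap d f : EuclideanSpace ℝ (Fin (d + 1) → V)) =
      WithLp.toLp 2 (X.upLap (d + 1) f.1.ofLp) := rfl

lemma cycleLap_isSymmetric : (X.cycleLap d).IsSymmetric := by
  intro f g
  rw [Submodule.coe_inner, Submodule.coe_inner, cycleLap_apply, cycleLap_apply]
  have h := sum_mul_upLap_comm (X := X) (mem_cycleSub.mp f.2).1.skew (mem_cycleSub.mp g.2).1.skew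
  simp only [PiLp.inner_apply, RCLike.inner_apply, conj_trivial]
  simp only [mul_comm] at h ⊢
  exact h.symm

lemma mem_specUpLapZ_of_hasEigenvalue {μ : ℝ}
    (h : Module.End.HasEigenvalue (X.cycleLap d) μ) : μ ∈ X.specUpLapZ d := by
  obtain ⟨f, hf⟩ := h.exists_hasEigenvector
  refine ⟨f.1.ofLp, (mem_cycleSub.mp f.2).1, (mem_cycleSub.mp f.2).2, ?_, ?_⟩
  · intro h0
    exact hf.2 (Subtype.ext (WithLp.ofLp_injective 2 h0))
  · have h1 := congrArg (fun u => WithLp.ofLp (Subtype.val u)) hf.apply_eq_smul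
    exact h1

lemma norm_smul_sub_upLap_le {k ε : ℝ} (hspec : ∀ μ ∈ X.specUpLapZ d, k - ε ≤ μ ∧ μ ≤ k + ε)
    {z : (Fin (d + 1) → V) → ℝ} (hz : X.IsForm (d + 1) z) (hz' : X.bdry d z = 0) :
    ‖WithLp.toLp 2 (k • z - X.upLap (d + 1) z)‖ ≤ ε * ‖WithLp.toLp 2 z‖ :=
  cycleLap_isSymmetric.norm_smul_sub_le (T := X.cycleLap d) (fun μ hμ => by
    have := hspec μ (mem_specUpLapZ_of_hasEigenvalue hμ)
    rw [abs_le]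
    constructor <;> linarith) ⟨WithLp.toLp 2 z, mem_cycleSub.mpr ⟨hz, hz'⟩⟩

end Spectrum

section Mixing

variable {V : Type} {d : ℕ} {A : Fin (d + 1) → Finset V} {C : Finset V}

lemma injective_of_mem (hA : Pairwise fun i j => Disjoint (A i) (A j))
    {σ : Fin (d + 1) → V} (hσ : ∀ i, σ i ∈ A i) : Function.Injective σ := by
  intro i j hij
  by_contra hne
  exact Finset.disjoint_left.mp (hA hne) (hσ i) (hij ▸ hσ j)

lemma pairwise_disjoint_update (hA : Pairwise fun i j => Disjoint (A i) (A j))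
    (hC : ∀ i, Disjoint C (A i)) :
    Pairwise fun i j => Disjoint (Function.update A 0 C i) (Function.update A 0 C j) := by
  intro i j hij
  rcases eq_or_ne i 0 with rfl | hi
  · rw [Function.update_self, Function.update_of_ne hij.symm]
    exact hC j
  · rw [Function.update_of_ne hi]
    rcases eq_or_ne j 0 with rfl | hj
    · rw [Function.update_self]
      exact (hC i).symm
    · rw [Function.update_of_ne hj]
      exact hA hij

variable [DecidableEq V]

lemma notMem_tset (hC : ∀ i, Disjoint C (A i)) {σ : Fin (d + 1) → V} (hσ : ∀ i, σ i ∈ A i)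
    {v : V} (hv : v ∈ C) : v ∉ tset σ := by
  simp only [tset, Finset.mem_image, Finset.mem_univ, true_and, not_exists]
  rintro i rfl
  exact Finset.disjoint_left.mp (hC i) hv (hσ i)

lemma minorForm_update_eq_zero (hA : Pairwise fun i j => Disjoint (A i) (A j))
    (hC : ∀ i, Disjoint C (A i)) {τ : Fin (d + 1) → V} (j : Fin (d + 1)) (hj : τ j ∈ A 0) :
    minorForm (Function.update A 0 C) τ = 0 := by
  refine minorForm_eq_zero_of_col j fun i => ?_
  rcases eq_or_ne i 0 with rfl | hi
  · rw [Function.update_self]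
    exact fun h => Finset.disjoint_left.mp (hC 0) h hj
  · rw [Function.update_of_ne hi]
    exact Finset.disjoint_left.mp (hA hi.symm) hj

lemma altFaces_minorForm_update (hA : Pairwise fun i j => Disjoint (A i) (A j))
    (hC : ∀ i, Disjoint C (A i)) {σ : Fin (d + 1) → V} (hσ : ∀ i, σ i ∈ A i) (v : V) :
    altFaces (minorForm (Function.update A 0 C)) (Fin.cons v σ) = if v ∈ C then -1 else 0 := by
  rw [altFaces_cons, minorForm_update_eq_zero hA hC 0 (hσ 0), Fin.sum_univ_succ,
    Finset.sum_eq_zero, add_zero]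
  · split_ifs with hv
    · rw [minorForm_eq_one (pairwise_disjoint_update hA hC)]
      · simp
      · intro i
        refine Fin.cases ?_ (fun i => ?_) i
        · simpa using hv
        · simpa [Function.update_of_ne (Fin.succ_ne_zero i)] using hσ i.succ
    · rw [minorForm_eq_zero_of_row 0]
      · simp
      · intro i
        rw [Function.update_self]
        refine Fin.cases ?_ (fun i => ?_) i
        · simpa using hv
        · simpa using Finset.disjoint_right.mp (hC i.succ) (hσ i.succ)
  · intro i _
    obtain ⟨l, hl⟩ := Fin.exists_succAbove_eq (Fin.succ_ne_zero i).symm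
    rw [minorForm_update_eq_zero hA hC l.succ (by simpa [hl] using hσ 0), mul_zero]

variable [Fintype V]

lemma altFaces_sumCons_minorForm_update (hA : Pairwise fun i j => Disjoint (A i) (A j))
    (hC : ∀ i, Disjoint C (A i)) {σ : Fin (d + 1) → V} (hσ : ∀ i, σ i ∈ A i) :
    altFaces (sumCons (minorForm (Function.update A 0 C))) σ = C.card := by
  have h := sumCons_altFaces (minorForm (Function.update A 0 C)) σ
  rw [minorForm_update_eq_zero hA hC 0 (hσ 0), sumCons] at h
  simp only [altFaces_minorForm_update hA hC hσ, Finset.sum_ite_mem, Finset.univ_inter] at h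
  simp at h
  linarith

lemma upLap_minorForm_update (X : SComplex V) (hA : Pairwise fun i j => Disjoint (A i) (A j))
    (hC : ∀ i, Disjoint C (A i)) {σ : Fin (d + 1) → V} (hσ : ∀ i, σ i ∈ A i) :
    X.upLap (d + 1) (minorForm (Function.update A 0 C)) σ =
      -((C.filter fun v => insert v (tset σ) ∈ X.cells).card : ℝ) := by
  rw [upLap, (isForm_cobdry (skew_minorForm _)).bdry_eq, sumCons, Finset.card_filter]
  push_cast
  rw [← Finset.sum_neg_distrib, ← Fintype.sum_ite_mem C]
  refine Finset.sum_congr rfl fun v _ => ?_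
  rw [cobdry_apply, altFaces_minorForm_update hA hC hσ]
  by_cases hv : v ∈ C
  · simp only [isCell_cons, nbr, injective_of_mem hA hσ, notMem_tset hC hσ hv, hv]
    split_ifs <;> simp_all
  · simp [hv]

/-- The mixing estimate for equal-size disjoint sets `C, A 0, …, A d`. -/
lemma mixing (X : SComplex V) (hX : X.CompleteSkeleton (d + 1)) {k ε : ℝ}
    (hspec : ∀ μ ∈ X.specUpLapZ d, k - ε ≤ μ ∧ μ ≤ k + ε)
    (hA : Pairwise fun i j => Disjoint (A i) (A j)) (hC : ∀ i, Disjoint C (A i))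
    {a : ℕ} (ha : 0 < a) (hAa : ∀ i, (A i).card = a) (hCa : C.card = a) :
    k * (a : ℝ) ^ (d + 2) - ε * Fintype.card V * (a : ℝ) ^ (d + 1) ≤ Fintype.card V *
      ∑ σ ∈ Fintype.piFinset A,
        ((C.filter fun v => insert v (tset σ) ∈ X.cells).card : ℝ) := by
  set n : ℝ := ((Fintype.card V : ℕ) : ℝ)
  have hn0 : 0 ≤ n := Nat.cast_nonneg _
  set N := ∑ σ ∈ Fintype.piFinset A,
    ((C.filter fun v => insert v (tset σ) ∈ X.cells).card : ℝ) with hN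
  set M : ℝ := ((d + 1).factorial : ℝ) with hM
  have hM0 : 0 < M := by positivity
  set f := minorForm A with hf
  set g := minorForm (Function.update A 0 C) with hg
  have hfs : Skew f := skew_minorForm A
  have hgs : Skew g := skew_minorForm _
  set b := altFaces (sumCons g) with hb
  set z := sumCons (altFaces g) with hz
  have hbs : Skew b := hgs.sumCons.altFaces
  have hzs : Skew z := hgs.altFaces.sumCons
  have hzg : z = n • g - b := funext fun σ => sumCons_altFaces g σ
  have hzform : X.IsForm (d + 1) z := hX.isForm le_rfl hzs
  have hzb : sumCons z = 0 := hgs.altFaces.sumCons_sumCons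
  have hzcyc : X.bdry d z = 0 := by rw [hzform.bdry_eq, hzb]
  have hcardA : ((Fintype.piFinset A).card : ℝ) = (a : ℝ) ^ (d + 1) := by
    simp [Fintype.card_piFinset, hAa]
  have hff : ∑ σ, f σ * f σ = M * (a : ℝ) ^ (d + 1) := by
    rw [sum_minorForm_mul A hfs, Finset.sum_congr rfl fun σ hσ =>
      minorForm_eq_one hA (Fintype.mem_piFinset.mp hσ)]
    simp [← hcardA, hM]
  have hgg : ∑ σ, g σ * g σ = M * (a : ℝ) ^ (d + 1) := by
    have hc : ∀ i, (Function.update A 0 C i).card = a := by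
      intro i
      rcases eq_or_ne i 0 with rfl | hi
      · rw [Function.update_self, hCa]
      · rw [Function.update_of_ne hi, hAa]
    rw [sum_minorForm_mul _ hgs, Finset.sum_congr rfl fun σ hσ =>
      minorForm_eq_one (pairwise_disjoint_update hA hC) (Fintype.mem_piFinset.mp hσ)]
    simp [Fintype.card_piFinset, hc, hM]
  have hfg : ∑ σ, f σ * g σ = 0 := by
    rw [sum_minorForm_mul A hgs, Finset.sum_eq_zero fun σ hσ =>
      minorForm_update_eq_zero hA hC 0 (Fintype.mem_piFinset.mp hσ 0), mul_zero]
  have hfb : ∑ σ, f σ * b σ = M * (a : ℝ) ^ (d + 2) := by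
    rw [sum_minorForm_mul A hbs, Finset.sum_congr rfl fun σ hσ =>
      altFaces_sumCons_minorForm_update hA hC (Fintype.mem_piFinset.mp hσ), hCa, Finset.sum_const,
      nsmul_eq_mul, hcardA]
    ring
  have hfL : ∑ σ, f σ * X.upLap (d + 1) g σ = - (M * N) := by
    rw [sum_minorForm_mul A (isForm_upLap hgs).skew, Finset.sum_congr rfl fun σ hσ =>
      upLap_minorForm_update X hA hC (Fintype.mem_piFinset.mp hσ), Finset.sum_neg_distrib]
    ring
  have hLz : X.upLap (d + 1) z = n • X.upLap (d + 1) g := by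
    have h1 : ∀ u, X.upLap (d + 1) u = (X.bdryL (d + 1) ∘ₗ X.cobdryL (d + 1)) u := fun u => rfl
    have h2 : X.upLap (d + 1) b = 0 := upLap_altFaces hgs.sumCons
    rw [hzg, h1, map_sub, map_smul, ← h1, ← h1, h2, sub_zero]
  have hS : inner ℝ (WithLp.toLp 2 f) (WithLp.toLp 2 (k • z - X.upLap (d + 1) z)) =
      n * (M * N) - k * (M * (a : ℝ) ^ (d + 2)) := by
    have h1 : ∑ σ, f σ * (k • z - X.upLap (d + 1) z) σ = k * n * ∑ σ, f σ * g σ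
        - k * ∑ σ, f σ * b σ - n * ∑ σ, f σ * X.upLap (d + 1) g σ := by
      rw [hLz, hzg]
      simp only [Finset.mul_sum, ← Finset.sum_sub_distrib]
      refine Finset.sum_congr rfl fun σ _ => ?_
      simp only [Pi.sub_apply, Pi.smul_apply, smul_eq_mul]
      ring
    rw [hfg, hfb, hfL] at h1
    simp only [PiLp.inner_apply, RCLike.inner_apply, conj_trivial]
    simp only [mul_comm _ (f _)]
    rw [h1]
    ring
  have hnorm : ∀ u : (Fin (d + 1) → V) → ℝ, ‖WithLp.toLp 2 u‖ ^ 2 = ∑ σ, u σ * u σ := by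
    intro u
    rw [EuclideanSpace.norm_sq_eq]
    exact Finset.sum_congr rfl fun σ _ => by simp [sq]
  have hzz : ‖WithLp.toLp 2 z‖ ≤ n * ‖WithLp.toLp 2 f‖ := by
    refine le_of_sq_le_sq ?_ (by positivity)
    rw [mul_pow, hnorm, hnorm, hff, ← hgg]
    have hbz : ∑ σ, b σ * z σ = 0 := by
      rw [hb, sum_altFaces_mul hzs, hzb]
      simp
    have hbb : 0 ≤ ∑ σ, b σ * b σ := Finset.sum_nonneg fun σ _ => mul_self_nonneg _
    have h1 : n ^ 2 * ∑ σ, g σ * g σ = ∑ σ, z σ * z σ + 2 * ∑ σ, b σ * z σ + ∑ σ, b σ * b σ := by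
      simp only [Finset.mul_sum, ← Finset.sum_add_distrib]
      refine Finset.sum_congr rfl fun σ _ => ?_
      rw [hzg]
      simp only [Pi.sub_apply, Pi.smul_apply, smul_eq_mul]
      ring
    linarith
  have hz0 : 0 < ‖WithLp.toLp 2 z‖ := by
    rw [norm_pos_iff]
    intro h0
    have h1 : z = 0 := congrArg WithLp.ofLp h0
    have h2 : ∑ σ, f σ * b σ = n * ∑ σ, f σ * g σ := by
      have h3 : b = n • g := by rw [h1] at hzg; exact (sub_eq_zero.mp hzg.symm).symm
      rw [h3, Finset.mul_sum]
      exact Finset.sum_congr rfl fun σ _ => by simp only [Pi.smul_apply, smul_eq_mul]; ring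
    rw [hfb, hfg, mul_zero] at h2
    have : (0 : ℝ) < M * (a : ℝ) ^ (d + 2) := by positivity
    linarith
  have hbound := norm_smul_sub_upLap_le hspec hzform hzcyc
  have hε : 0 ≤ ε := nonneg_of_mul_nonneg_left ((norm_nonneg _).trans hbound) hz0
  have hCS := (abs_le.mp (abs_real_inner_le_norm (WithLp.toLp 2 f)
    (WithLp.toLp 2 (k • z - X.upLap (d + 1) z)))).1
  rw [hS] at hCS
  have h1 : ‖WithLp.toLp 2 f‖ * ‖WithLp.toLp 2 (k • z - X.upLap (d + 1) z)‖ ≤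
      ε * n * (M * (a : ℝ) ^ (d + 1)) := by
    calc _ ≤ ‖WithLp.toLp 2 f‖ * (ε * (n * ‖WithLp.toLp 2 f‖)) := by gcongr; exact hbound.trans (by gcongr)
      _ = ε * n * ‖WithLp.toLp 2 f‖ ^ 2 := by ring
      _ = _ := by rw [hnorm, hff]
  refine le_of_mul_le_mul_left ?_ hM0
  linarith

end Mixing

end SComplex

section Selection

open Filter Topology

lemma exists_stdSimplex_of_mem_convexHull_range {κ E : Type*} [Fintype κ] [AddCommGroup E]
    [Module ℝ E] {ψ : κ → E} {x : E} (hx : x ∈ convexHull ℝ (Set.range ψ)) :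
    ∃ w ∈ stdSimplex ℝ κ, ∑ i, w i • ψ i = x := by
  classical
  have h : Set.range ψ = Fintype.linearCombination ℝ ψ '' Set.range fun i : κ => Pi.single i 1 := by
    rw [← Set.range_comp]
    congr 1
    funext i
    simp
  rw [h, ← LinearMap.image_convexHull, convexHull_rangle_single_eq_stdSimplex] at hx
  simpa [Fintype.linearCombination_apply] using hx

variable {E : Type*} [NormedAddCommGroup E] [NormedSpace ℝ E]

/-- Points in the convex hulls of a convergent family of finite configurations converge, along an
ultrafilter, to a point in the convex hull of the limit. -/
lemma Ultrafilter.exists_tendsto_mem_convexHull_range {α κ : Type*} [Finite κ]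
    {U : Ultrafilter α} {ψ : α → κ → E} {ψ₀ : κ → E} (hψ : Tendsto ψ U (𝓝 ψ₀)) {x : α → E}
    (hx : ∀ᶠ t in (U : Filter α), x t ∈ convexHull ℝ (Set.range (ψ t))) :
    ∃ y ∈ convexHull ℝ (Set.range ψ₀), Tendsto x U (𝓝 y) := by
  have := Fintype.ofFinite κ
  have h : ∀ t, ∃ w : κ → ℝ, x t ∈ convexHull ℝ (Set.range (ψ t)) →
      w ∈ stdSimplex ℝ κ ∧ ∑ i, w i • ψ t i = x t := by
    intro t
    by_cases ht : x t ∈ convexHull ℝ (Set.range (ψ t))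
    · obtain ⟨w, hw⟩ := exists_stdSimplex_of_mem_convexHull_range ht
      exact ⟨w, fun _ => hw⟩
    · exact ⟨0, fun h => absurd h ht⟩
  choose w hw using h
  obtain ⟨w₀, hw₀, hlim⟩ := (isCompact_stdSimplex ℝ κ).ultrafilter_le_nhds (U.map w)
    (le_principal_iff.mpr (hx.mono fun t ht => (hw t ht).1))
  refine ⟨∑ i, w₀ i • ψ₀ i, (convex_convexHull ℝ _).sum_mem (fun i _ => hw₀.1 i) hw₀.2
    fun i _ => subset_convexHull ℝ _ (Set.mem_range_self i), ?_⟩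
  have hw' : Tendsto w U (𝓝 w₀) := hlim
  have h1 : Tendsto (fun t => ∑ i, w t i • ψ t i) U (𝓝 (∑ i, w₀ i • ψ₀ i)) :=
    tendsto_finsetSum _ fun i _ => (tendsto_pi_nhds.mp hw' i).smul (tendsto_pi_nhds.mp hψ i)
  exact h1.congr' (hx.mono fun t ht => (hw t ht).2)

lemma eventually_injective_add_smul {V : Type*} [Finite V] (φ : V → E) {e : V → E}
    (he : Function.Injective e) : ∀ᶠ t in 𝓝[≠] (0 : ℝ), Function.Injective (φ + t • e) := by
  have h : ∀ p : V × V, ∀ᶠ t in 𝓝[≠] (0 : ℝ), (φ + t • e) p.1 = (φ + t • e) p.2 → p.1 = p.2 := by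
    rintro ⟨v, w⟩
    by_cases hφ : φ v = φ w
    · filter_upwards [self_mem_nhdsWithin] with t ht h
      simp only [Pi.add_apply, Pi.smul_apply, hφ, add_right_inj] at h
      exact he (smul_right_injective E ht h)
    · have hc : ∀ u : V, Tendsto (fun t : ℝ => (φ + t • e) u) (𝓝[≠] 0) (𝓝 (φ u)) := by
        intro u
        have : Continuous fun t : ℝ => (φ + t • e) u := by
          simp only [Pi.add_apply, Pi.smul_apply]
          fun_prop
        simpa using (this.tendsto 0).mono_left nhdsWithin_le_nhds
      filter_upwards [((hc v).sub (hc w)).eventually_ne (sub_ne_zero.mpr hφ)] with t ht h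
      exact absurd (sub_eq_zero.mpr h) ht
  filter_upwards [eventually_all.mpr h] with t ht v w hvw
  exact ht (v, w) hvw

variable {V κ : Type*} {cd : ℝ} {N : ℕ} {P : κ → Finset V}

lemma exists_selection_of_injective
    (hpach : ∀ P : κ → Finset E,
      (∀ i j, i ≠ j → Disjoint (P i) (P j)) → (∀ i j, (P i).card = (P j).card) →
      ∃ (Q : κ → Finset E) (x : E),
        (∀ i, Q i ⊆ P i ∧ cd * ((P i).card : ℝ) ≤ ((Q i).card : ℝ)) ∧
        ∀ q : κ → E, (∀ i, q i ∈ Q i) → x ∈ convexHull ℝ (Set.range q))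
    (hP : ∀ i j, i ≠ j → Disjoint (P i) (P j)) (hN : ∀ i, (P i).card = N) {ψ : V → E}
    (hψ : Function.Injective ψ) :
    ∃ Q : κ → Finset V, (∀ i, Q i ⊆ P i ∧ (Q i).card = ⌈cd * N⌉₊) ∧
      ∃ x, ∀ q : κ → V, (∀ i, q i ∈ Q i) → x ∈ convexHull ℝ (Set.range (ψ ∘ q)) := by
  classical
  obtain ⟨Q, x, hQ, hx⟩ := hpach (fun i => (P i).map ⟨ψ, hψ⟩)
    (fun i j hij => (Finset.disjoint_map _).mpr (hP i j hij)) (fun i j => by simp [hN])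
  have h : ∀ i, ∃ R ⊆ (P i).filter (fun v => ψ v ∈ Q i), R.card = ⌈cd * N⌉₊ := by
    intro i
    refine Finset.exists_subset_card_eq (Nat.ceil_le.mpr ?_)
    have h1 := (hQ i).2
    rw [Finset.card_map, hN] at h1
    refine h1.trans (Nat.cast_le.mpr ?_)
    rw [← Finset.card_map ⟨ψ, hψ⟩]
    refine Finset.card_le_card fun y hy => ?_
    obtain ⟨v, hv, rfl⟩ := Finset.mem_map.mp ((hQ i).1 hy)
    exact Finset.mem_map_of_mem _ (Finset.mem_filter.mpr ⟨hv, hy⟩)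
  choose R hR hRc using h
  exact ⟨R, fun i => ⟨(hR i).trans (Finset.filter_subset _ _), hRc i⟩, x, fun q hq =>
    hx _ fun i => (Finset.mem_filter.mp (hR i (hq i))).2⟩

/-- The selection property for vertex sets mapped to space by a map that need not be injective. -/
lemma exists_selection [Finite V] [Finite κ] [Nontrivial E]
    (hpach : ∀ P : κ → Finset E,
      (∀ i j, i ≠ j → Disjoint (P i) (P j)) → (∀ i j, (P i).card = (P j).card) →
      ∃ (Q : κ → Finset E) (x : E),
        (∀ i, Q i ⊆ P i ∧ cd * ((P i).card : ℝ) ≤ ((Q i).card : ℝ)) ∧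
        ∀ q : κ → E, (∀ i, q i ∈ Q i) → x ∈ convexHull ℝ (Set.range q))
    (hP : ∀ i j, i ≠ j → Disjoint (P i) (P j)) (hN : ∀ i, (P i).card = N) (φ : V → E) :
    ∃ Q : κ → Finset V, (∀ i, Q i ⊆ P i ∧ (Q i).card = ⌈cd * N⌉₊) ∧
      ∃ x, ∀ q : κ → V, (∀ i, q i ∈ Q i) → x ∈ convexHull ℝ (Set.range (φ ∘ q)) := by
  have : Infinite E := Module.Free.infinite ℝ E
  let e : V ↪ E := (Finite.equivFin V).toEmbedding.trans
    (Fin.valEmbedding.trans (Infinite.natEmbedding E))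
  obtain ⟨U, hU⟩ := Ultrafilter.exists_le (𝓝[≠] (0 : ℝ))
  obtain ⟨Q, hQ⟩ := Ultrafilter.eventually_exists_iff.mp (((eventually_injective_add_smul φ
    e.injective).filter_mono hU).mono fun t ht => exists_selection_of_injective hpach hP hN ht)
  refine ⟨Q, (hQ.exists.choose_spec).1, ?_⟩
  by_cases hne : ∃ q : κ → V, ∀ i, q i ∈ Q i
  swap
  · exact ⟨0, fun q hq => absurd ⟨q, hq⟩ hne⟩
  have hx : ∀ t : ℝ, ∃ x : E, (∃ x, ∀ q : κ → V, (∀ i, q i ∈ Q i) →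
      x ∈ convexHull ℝ (Set.range ((φ + t • (e : V → E)) ∘ q))) → ∀ q : κ → V, (∀ i, q i ∈ Q i) →
      x ∈ convexHull ℝ (Set.range ((φ + t • (e : V → E)) ∘ q)) := by
    intro t
    by_cases ht : ∃ x, ∀ q : κ → V, (∀ i, q i ∈ Q i) →
      x ∈ convexHull ℝ (Set.range ((φ + t • (e : V → E)) ∘ q))
    · obtain ⟨x, hx⟩ := ht
      exact ⟨x, fun _ => hx⟩
    · exact ⟨0, fun h => absurd h ht⟩
  choose x hx using hx
  have hlim : ∀ q : κ → V, (∀ i, q i ∈ Q i) →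
      ∃ y ∈ convexHull ℝ (Set.range (φ ∘ q)), Tendsto x U (𝓝 y) := by
    intro q hq
    refine Ultrafilter.exists_tendsto_mem_convexHull_range
      (ψ := fun t => (φ + t • (e : V → E)) ∘ q) ?_ (hQ.mono fun t ht => hx t ht.2 q hq)
    have hc : Continuous fun t : ℝ => (φ + t • (e : V → E)) ∘ q := by
      refine continuous_pi fun i => ?_
      simp only [Function.comp_apply, Pi.add_apply, Pi.smul_apply]
      fun_prop
    have := (hc.tendsto 0).mono_left (hU.trans nhdsWithin_le_nhds)
    simpa using this
  obtain ⟨q₀, hq₀⟩ := hne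
  obtain ⟨y, -, hy⟩ := hlim q₀ hq₀
  refine ⟨y, fun q hq => ?_⟩
  obtain ⟨y', hy', hlim'⟩ := hlim q hq
  rwa [tendsto_nhds_unique hy hlim']

end Selection

namespace SComplex

section Counting

variable {V : Type} [Fintype V] [DecidableEq V]

lemma mem_cellsCard {X : SComplex V} {m : ℕ} {s : Finset V} :
    s ∈ X.cellsCard m ↔ s ∈ X.cells ∧ s.card = m := Finset.mem_filter

lemma card_cellsCard_le (X : SComplex V) (m : ℕ) :
    (X.cellsCard m).card ≤ (Fintype.card V).choose m := by
  rw [← Finset.card_univ, ← Finset.card_powersetCard]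
  exact Finset.card_le_card fun s hs =>
    Finset.mem_powersetCard.mpr ⟨Finset.subset_univ s, (mem_cellsCard.mp hs).2⟩

lemma sum_degCell (X : SComplex V) (m : ℕ) :
    ∑ s ∈ X.cellsCard m, X.degCell s = (m + 1) * (X.cellsCard (m + 1)).card := by
  have h := Finset.sum_card_bipartiteAbove_eq_sum_card_bipartiteBelow
    (s := X.cellsCard m) (t := X.cellsCard (m + 1)) (fun s t : Finset V => s ⊆ t)
  have h1 : ∀ s ∈ X.cellsCard m,
      (Finset.bipartiteAbove (fun s t : Finset V => s ⊆ t) (X.cellsCard (m + 1)) s).card =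
        X.degCell s := by
    intro s hs
    rw [degCell, (mem_cellsCard.mp hs).2]
    congr 1
    ext t
    simp only [Finset.bipartiteAbove, Finset.mem_filter, mem_cellsCard]
    tauto
  have h2 : ∀ t ∈ X.cellsCard (m + 1),
      (Finset.bipartiteBelow (fun s t : Finset V => s ⊆ t) (X.cellsCard m) t).card = m + 1 := by
    intro t ht
    have ht := mem_cellsCard.mp ht
    have : Finset.bipartiteBelow (fun s t : Finset V => s ⊆ t) (X.cellsCard m) t =
        t.powersetCard m := by
      ext s
      simp only [Finset.bipartiteBelow, Finset.mem_filter, mem_cellsCard, Finset.mem_powersetCard]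
      exact ⟨fun h => ⟨h.2, h.1.2⟩, fun h => ⟨⟨X.down_closed t ht.1 s h.1, h.2⟩, h.1⟩⟩
    rw [this, Finset.card_powersetCard, ht.2, Nat.choose_succ_self_right]
  rw [Finset.sum_congr rfl h1, Finset.sum_congr rfl h2, Finset.sum_const, smul_eq_mul] at h
  rw [h, mul_comm]

/-- The transversal cells of disjoint sets `C, A 0, …, A d` are counted once by tuples. -/
lemma sum_card_transversal_le (X : SComplex V) {d : ℕ} {A : Fin (d + 1) → Finset V}
    {C : Finset V} (hA : Pairwise fun i j => Disjoint (A i) (A j)) (hC : ∀ i, Disjoint C (A i))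
    {T : Finset (Finset V)} (hT : ∀ σ : Fin (d + 1) → V, (∀ i, σ i ∈ A i) → ∀ v ∈ C,
      insert v (tset σ) ∈ X.cellsCard (d + 2) → insert v (tset σ) ∈ T) :
    ∑ σ ∈ Fintype.piFinset A, (C.filter fun v => insert v (tset σ) ∈ X.cells).card ≤ T.card := by
  rw [← Finset.card_sigma]
  refine Finset.card_le_card_of_injOn (fun p => insert p.2 (tset p.1)) ?_ ?_
  · rintro ⟨σ, v⟩ h
    simp only [Finset.coe_sigma, Set.mem_sigma_iff, Finset.mem_coe, Fintype.mem_piFinset,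
      Finset.mem_filter] at h
    refine hT σ h.1 v h.2.1 (mem_cellsCard.mpr ⟨h.2.2, ?_⟩)
    rw [Finset.card_insert_of_notMem (notMem_tset hC h.1 h.2.1), tset,
      Finset.card_image_of_injective _ (injective_of_mem hA h.1)]
    simp
  · rintro ⟨σ, v⟩ h ⟨σ', v'⟩ h' heq
    simp only [Finset.coe_sigma, Set.mem_sigma_iff, Finset.mem_coe, Fintype.mem_piFinset,
      Finset.mem_filter] at h h' heq
    have hv : v = v' := by
      have : v ∈ insert v' (tset σ') := heq ▸ Finset.mem_insert_self _ _
      exact (Finset.mem_insert.mp this).resolve_right (notMem_tset hC h'.1 h.2.1)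
    have hσ : σ = σ' := by
      funext i
      have : σ i ∈ insert v' (tset σ') := by
        rw [← heq]
        exact Finset.mem_insert_of_mem (Finset.mem_image_of_mem _ (Finset.mem_univ i))
      rcases Finset.mem_insert.mp this with h1 | h1
      · exact absurd (h1 ▸ h'.2.1) (Finset.disjoint_right.mp (hC i) (h.1 i))
      · obtain ⟨j, -, hj⟩ := Finset.mem_image.mp h1
        rcases eq_or_ne i j with rfl | hij
        · exact hj.symm
        · exact absurd (hj ▸ h'.1 j) (Finset.disjoint_left.mp (hA hij) (h.1 i))
    rw [hv, hσ]

end Counting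

end SComplex

/-- A set of size `(d + 2) N` splits into `d + 2` disjoint sets of size `N`. -/
lemma exists_equipartition (V : Type*) [Fintype V] {m N : ℕ} (h : Fintype.card V = m * N) :
    ∃ P : Fin m → Finset V, (∀ i j, i ≠ j → Disjoint (P i) (P j)) ∧ ∀ i, (P i).card = N := by
  classical
  have e : V ≃ Fin m × Fin N := Fintype.equivOfCardEq (by simp [h])
  refine ⟨fun i => Finset.univ.map ((Function.Embedding.sectR i (Fin N)).trans e.symm.toEmbedding),
    fun i j hij => ?_, fun i => by simp⟩
  rw [Finset.disjoint_left]
  intro v hi hj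
  obtain ⟨x, -, rfl⟩ := Finset.mem_map.mp hi
  obtain ⟨y, -, hy⟩ := Finset.mem_map.mp hj
  have h1 := e.symm.injective hy
  exact hij (congrArg Prod.fst h1).symm

/-- The numerical estimate turning the mixing bound into a bound for the covered fraction. -/
lemma overlap_numeric {d N a : ℕ} {cd k ε S T M : ℝ} (hN : 0 < N) (hcd : 0 < cd)
    (ha : cd * N ≤ a) (hk : 0 < k) (hT : (d + 2) * T ≤ k * S)
    (hS : S ≤ (((d + 2) * N : ℕ) : ℝ) ^ (d + 1) / (d + 1).factorial) (hT0 : 0 ≤ T) (hM0 : 0 ≤ M)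
    (hM : k * (a : ℝ) ^ (d + 2) - ε * ((d + 2) * N : ℕ) * (a : ℝ) ^ (d + 1) ≤
      ((d + 2) * N : ℕ) * M) :
    (cd ^ (d + 1) / Real.exp 1 ^ (d + 2)) * (cd - ε * ((d : ℝ) + 2) / k) * T ≤ M := by
  set δ := cd - ε * ((d : ℝ) + 2) / k with hδ
  have hN' : (0 : ℝ) < N := Nat.cast_pos.mpr hN
  rcases le_or_gt δ 0 with h0 | h0
  · refine le_trans ?_ hM0
    exact mul_nonpos_of_nonpos_of_nonneg (mul_nonpos_of_nonneg_of_nonpos (by positivity) h0) hT0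
  push_cast at hS hM
  have hexp : ((d : ℝ) + 2) ^ (d + 2) / (d + 2).factorial ≤ Real.exp 1 ^ (d + 2) := by
    rw [Real.exp_one_pow]
    have := Real.pow_div_factorial_le_exp (x := (d : ℝ) + 2) (by positivity) (d + 2)
    exact_mod_cast this
  have hfac : ((d + 2).factorial : ℝ) = (d + 2) * (d + 1).factorial := by
    rw [Nat.factorial_succ]; push_cast; ring
  have hTle : T ≤ k / (d + 2) * (N : ℝ) ^ (d + 1) * Real.exp 1 ^ (d + 2) := by
    calc T ≤ k * S / (d + 2) := by rw [le_div_iff₀ (by positivity)]; linarith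
      _ ≤ k * ((((d : ℝ) + 2) * N) ^ (d + 1) / (d + 1).factorial) / (d + 2) := by gcongr
      _ = k / (d + 2) * (N : ℝ) ^ (d + 1) * (((d : ℝ) + 2) ^ (d + 2) / (d + 2).factorial) := by
        rw [hfac, mul_pow]; field_simp; ring
      _ ≤ _ := by gcongr
  have hδ' : k / (d + 2) * δ = k * cd / (d + 2) - ε := by
    rw [hδ]; field_simp
  calc cd ^ (d + 1) / Real.exp 1 ^ (d + 2) * δ * T
      ≤ cd ^ (d + 1) / Real.exp 1 ^ (d + 2) * δ *
        (k / (d + 2) * (N : ℝ) ^ (d + 1) * Real.exp 1 ^ (d + 2)) := by gcongr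
    _ = (cd * N) ^ (d + 1) * (k / (d + 2) * δ) := by rw [mul_pow]; field_simp
    _ ≤ (a : ℝ) ^ (d + 1) * (k / (d + 2) * δ) := by gcongr
    _ = (k * (cd * N) * (a : ℝ) ^ (d + 1) - ε * ((d + 2) * N) * (a : ℝ) ^ (d + 1)) /
        ((d + 2) * N) := by rw [hδ']; field_simp
    _ ≤ (k * a * (a : ℝ) ^ (d + 1) - ε * ((d + 2) * N) * (a : ℝ) ^ (d + 1)) /
        ((d + 2) * N) := by gcongr
    _ ≤ M := by
      rw [div_le_iff₀ (by positivity)]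
      calc _ = k * (a : ℝ) ^ (d + 2) - ε * ((d + 2) * N) * (a : ℝ) ^ (d + 1) := by ring
        _ ≤ _ := by linarith

open SComplex in
open Classical in
/-- Corollary 1.6 (geometric overlap): let `c_d > 0` satisfy Pach's selection property in
`ℝ^{d+1}`. If `X` is a `(d+1)`-dimensional complex with complete skeleton, whose number
of vertices is divisible by `d+2`, `k` is the average degree of a cell with `d+1`
vertices, and `Spec(Δ⁺|_Z) ⊆ [k-ε, k+ε]`, then for every map `φ : V → ℝ^{d+1}` some
point is covered by at least a `(c_d^{d+1}/e^{d+2})·(c_d - ε(d+2)/k)` fraction of the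
top-dimensional cells, i.e. `overlap(X) ≥ (c_d^{d+1}/e^{d+2})·(c_d - ε(d+2)/k)`. -/
theorem overlap_from_spectrum (V : Type) [Fintype V] [DecidableEq V] (d : ℕ)
    (X : SComplex V) (hdim : X.Dim (d + 1)) (hskel : X.CompleteSkeleton (d + 1))
    (hdvd : (d + 2) ∣ Fintype.card V)
    (cd : ℝ) (hcd : 0 < cd)
    (hpach : ∀ P : Fin (d + 2) → Finset (EuclideanSpace ℝ (Fin (d + 1))),
      (∀ i j, i ≠ j → Disjoint (P i) (P j)) → (∀ i j, (P i).card = (P j).card) →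
      ∃ (Q : Fin (d + 2) → Finset (EuclideanSpace ℝ (Fin (d + 1))))
        (x : EuclideanSpace ℝ (Fin (d + 1))),
        (∀ i, Q i ⊆ P i ∧ cd * ((P i).card : ℝ) ≤ ((Q i).card : ℝ)) ∧
        ∀ q : Fin (d + 2) → EuclideanSpace ℝ (Fin (d + 1)),
          (∀ i, q i ∈ Q i) → x ∈ convexHull ℝ (Set.range q))
    (k ε : ℝ)
    (hk : k = (∑ s ∈ X.cellsCard (d + 1), (X.degCell s : ℝ)) /
        ((X.cellsCard (d + 1)).card : ℝ))
    (hspec : ∀ μ ∈ X.specUpLapZ d, k - ε ≤ μ ∧ μ ≤ k + ε) :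
    ∀ φ : V → EuclideanSpace ℝ (Fin (d + 1)),
      ∃ x : EuclideanSpace ℝ (Fin (d + 1)),
        (cd ^ (d + 1) / Real.exp 1 ^ (d + 2)) * (cd - ε * ((d : ℝ) + 2) / k) *
            ((X.cellsCard (d + 2)).card : ℝ) ≤
          (((X.cellsCard (d + 2)).filter
            (fun s => x ∈ convexHull ℝ (φ '' (s : Set V)))).card : ℝ) := by
  intro φ
  obtain ⟨N, hN⟩ := hdvd
  obtain ⟨s₀, hs₀, hs₀c⟩ := hdim.2
  have hV : 0 < Fintype.card V :=
    lt_of_lt_of_le (by omega) (hs₀c ▸ Finset.card_le_univ s₀)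
  have hN0 : 0 < N := Nat.pos_of_mul_pos_left (hN ▸ hV)
  obtain ⟨P, hP, hPN⟩ := exists_equipartition V hN
  obtain ⟨Q, hQ, x, hx⟩ := exists_selection hpach hP hPN φ
  refine ⟨x, ?_⟩
  set a := ⌈cd * N⌉₊
  have ha0 : 0 < a := Nat.ceil_pos.mpr (by positivity)
  have hdisj : ∀ i j, i ≠ j → Disjoint (Q i) (Q j) := fun i j hij =>
    Finset.disjoint_of_subset_left (hQ i).1 (Finset.disjoint_of_subset_right (hQ j).1 (hP i j hij))
  have hA : Pairwise fun i j : Fin (d + 1) => Disjoint (Q i.succ) (Q j.succ) :=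
    fun i j hij => hdisj _ _ (by simpa using hij)
  have hC : ∀ i : Fin (d + 1), Disjoint (Q 0) (Q i.succ) :=
    fun i => hdisj _ _ (Fin.succ_ne_zero i).symm
  have hmix := mixing X hskel hspec hA hC ha0 (fun i => (hQ i.succ).2) (hQ 0).2
  have hcount := sum_card_transversal_le X hA hC
    (T := (X.cellsCard (d + 2)).filter fun s : Finset V => x ∈ convexHull ℝ (φ '' (s : Set V))) (by
      intro σ hσ v hv hcell
      refine Finset.mem_filter.mpr ⟨hcell, ?_⟩
      have h := hx (Fin.cons v σ) (fun i => Fin.cases hv hσ i)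
      rw [← tset_cons, tset, Finset.coe_image, Finset.coe_univ, Set.image_univ, ← Set.range_comp]
      exact h)
  have hdeg : k * ((X.cellsCard (d + 1)).card : ℝ) =
      ((d : ℝ) + 2) * ((X.cellsCard (d + 2)).card : ℝ) ∧ 0 < k := by
    have hsum : (∑ s ∈ X.cellsCard (d + 1), (X.degCell s : ℝ)) =
        ((d : ℝ) + 2) * ((X.cellsCard (d + 2)).card : ℝ) := by
      have := congrArg (Nat.cast : ℕ → ℝ) (sum_degCell X (d + 1))
      push_cast at this
      rw [this]
      ring
    have hpos : 0 < (X.cellsCard (d + 2)).card :=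
      Finset.card_pos.mpr ⟨s₀, mem_cellsCard.mpr ⟨hs₀, hs₀c⟩⟩
    have hpos' : (0 : ℝ) < ((d : ℝ) + 2) * ((X.cellsCard (d + 2)).card : ℝ) := by positivity
    have hS : (0 : ℝ) < (X.cellsCard (d + 1)).card := by
      rw [Nat.cast_pos, Finset.card_pos, Finset.nonempty_iff_ne_empty]
      intro h
      rw [h, Finset.sum_empty] at hsum
      exact hpos'.ne hsum
    rw [hsum] at hk
    exact ⟨by rw [hk]; field_simp, hk ▸ div_pos hpos' hS⟩
  refine overlap_numeric (S := ((X.cellsCard (d + 1)).card : ℝ)) hN0 hcd (Nat.le_ceil _) hdeg.2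
    hdeg.1.ge ?_ (Nat.cast_nonneg _) (Nat.cast_nonneg _) ?_
  · rw [← hN]
    exact (Nat.cast_le.mpr (card_cellsCard_le X (d + 1))).trans (Nat.choose_le_pow_div _ _)
  · rw [← hN]
    refine hmix.trans ?_
    gcongr
    rw [← Nat.cast_sum]
    refine Nat.cast_le.mpr (hcount.trans ?_)
    refine Finset.card_le_card_of_injOn (fun s : Finset V => (s : Set V)) (fun s hs => ?_)
      Finset.coe_injective.injOn
    obtain ⟨hs, hxs⟩ := Finset.mem_filter.mp hs
    exact Finset.mem_filter.mpr ⟨by simpa using hs, hxs⟩
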